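/- Let ε_TP(μ, μ̃) := 1 − F(μ, μ̃) be the teleportation infidelity, where F(μ, μ̃) := (1 − 4μ̃·[√(4μ² − 1) + μ̃ − 2μ(1 + 2μ̃·ξ(μ))])^(−1/4) and ξ(μ) := 2μ − √(4μ² − 1). Then the two iterated limits of ε_TP do not agree: for every fixed μ̃ ≥ 1/2 one has lim_{μ→∞} ε_TP(μ, μ̃) = 0 (so the iterated limit taking μ → ∞ first equals 0), while for every fixed μ ≥ 1/2 one has lim_{μ̃→∞} ε_TP(μ, μ̃) = 1 (so the iterated limit taking μ̃ → ∞ first equals 1). Hence the joint limit in the simulation energy μ and the input energy μ̃ is not mathematically defined. -/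

import Mathlib

/-- Added noise of the μ-energy Braunstein–Kimble teleportation protocol. -/
noncomputable def xiBK (μ : ℝ) : ℝ := 2*μ - Real.sqrt (4*μ^2 - 1)

/-- Fidelity between a TMSV state of energy μ̃ and its output under the
μ-energy BK teleportation channel. -/
noncomputable def FBK (μ μt : ℝ) : ℝ :=
  (1 - 4*μt*(Real.sqrt (4*μ^2 - 1) + μt - 2*μ*(1 + 2*μt*xiBK μ))) ^ (-(1/4 : ℝ))

/-- Teleportation infidelity. -/
noncomputable def epsTP (μ μt : ℝ) : ℝ := 1 - FBK μ μt

theorem xiBK_eq_inv {μ : ℝ} (hμ : 1/2 ≤ μ) :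
    xiBK μ = (2*μ + Real.sqrt (4*μ^2 - 1))⁻¹ := by
  have hs := Real.sq_sqrt (show (0 : ℝ) ≤ 4*μ^2 - 1 by nlinarith)
  have h0 := Real.sqrt_nonneg (4*μ^2 - 1)
  rw [xiBK]
  apply eq_inv_of_mul_eq_one_left
  linear_combination -hs

theorem xiBK_pos {μ : ℝ} (hμ : 1/2 ≤ μ) : 0 < xiBK μ := by
  have h0 := Real.sqrt_nonneg (4*μ^2 - 1)
  rw [xiBK_eq_inv hμ]
  exact inv_pos.mpr (by linarith)

theorem tendsto_xiBK : Filter.Tendsto xiBK Filter.atTop (nhds 0) := by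
  have h : Filter.Tendsto (fun μ : ℝ => 2*μ + Real.sqrt (4*μ^2 - 1))
      Filter.atTop Filter.atTop :=
    Filter.tendsto_atTop_mono (fun _ => le_add_of_nonneg_right (Real.sqrt_nonneg _))
      (Filter.tendsto_id.const_mul_atTop two_pos)
  refine h.inv_tendsto_atTop.congr' ?_
  filter_upwards [Filter.eventually_ge_atTop (1/2 : ℝ)] with μ hμ
  exact (xiBK_eq_inv hμ).symm

theorem FBK_eq {μ : ℝ} (hμ : 1/2 ≤ μ) (μt : ℝ) :
    FBK μ μt = ((1 + 2*μt*xiBK μ)^2) ^ (-(1/4 : ℝ)) := by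
  have hs := Real.sq_sqrt (show (0 : ℝ) ≤ 4*μ^2 - 1 by nlinarith)
  rw [FBK, xiBK]
  congr 1
  linear_combination (-4*μt^2) * hs

theorem bk_iterated_limits_disagree :
    (∀ μt : ℝ, 1/2 ≤ μt →
      Filter.Tendsto (fun μ : ℝ => epsTP μ μt) Filter.atTop (nhds 0)) ∧
    (∀ μ : ℝ, 1/2 ≤ μ →
      Filter.Tendsto (fun μt : ℝ => epsTP μ μt) Filter.atTop (nhds 1)) := by
  refine ⟨fun μt _ => ?_, fun μ hμ => ?_⟩
  · have hbase : Filter.Tendsto (fun μ : ℝ => (1 + 2*μt*xiBK μ)^2) Filter.atTop (nhds 1) := by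
      simpa using ((tendsto_xiBK.const_mul (2*μt)).const_add 1).pow 2
    have hF := (hbase.rpow_const (p := -(1/4 : ℝ)) (Or.inl one_ne_zero)).const_sub 1
    rw [Real.one_rpow, sub_self] at hF
    refine hF.congr' ?_
    filter_upwards [Filter.eventually_ge_atTop (1/2 : ℝ)] with μ hμ
    rw [epsTP, FBK_eq hμ]
  · have hlin : Filter.Tendsto (fun μt : ℝ => 1 + 2*μt*xiBK μ) Filter.atTop Filter.atTop :=
      Filter.tendsto_atTop_add_const_left _ _
        ((Filter.tendsto_id.const_mul_atTop two_pos).atTop_mul_const (xiBK_pos hμ))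
    have hbase := (Filter.tendsto_pow_atTop two_ne_zero).comp hlin
    have hF := ((tendsto_rpow_neg_atTop (y := 1/4) (by norm_num)).comp hbase).const_sub 1
    rw [sub_zero] at hF
    refine hF.congr fun μt => ?_
    rw [epsTP, FBK_eq hμ]
    rfl
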